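/- Every doubly even self-dual binary [112,56] code with minimum weight 20 has exactly 355740 codewords of weight 20, exactly 95307030 codewords of weight 24, and exactly 10847290300 codewords of weight 28. -/

import Mathlib

/-- The (Hamming) weight of a vector over `ZMod 2`. -/
def wt {ι : Type*} [Fintype ι] (x : ι → ZMod 2) : ℕ :=
  (Finset.univ.filter fun i => x i ≠ 0).card

/-- The dual code of a binary linear code. -/
def dualCode {ι : Type*} [Fintype ι] (C : Submodule (ZMod 2) (ι → ZMod 2)) :
    Submodule (ZMod 2) (ι → ZMod 2) where
  carrier := {x | ∀ c ∈ C, ∑ i, x i * c i = 0}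
  zero_mem' := by intro c _; simp
  add_mem' := by
    intro a b ha hb c hc
    simp only [Set.mem_setOf_eq] at ha hb ⊢
    simp [Pi.add_apply, add_mul, Finset.sum_add_distrib, ha c hc, hb c hc]
  smul_mem' := by
    intro r a ha c hc
    simp only [Set.mem_setOf_eq] at ha ⊢
    simp [Pi.smul_apply, smul_eq_mul, mul_assoc, ← Finset.mul_sum, ha c hc]

/-- A binary linear code is self-dual if it equals its dual. -/
def IsSelfDual {ι : Type*} [Fintype ι] (C : Submodule (ZMod 2) (ι → ZMod 2)) : Prop :=
  C = dualCode C

/-- A binary code is even if every codeword has even weight. -/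
def IsEvenCode {ι : Type*} [Fintype ι] (C : Submodule (ZMod 2) (ι → ZMod 2)) : Prop :=
  ∀ c ∈ C, 2 ∣ wt c

/-- `C` has minimum weight `d`: some nonzero codeword has weight `d` and
no nonzero codeword has smaller weight. -/
def HasMinWt {ι : Type*} [Fintype ι] (C : Submodule (ZMod 2) (ι → ZMod 2)) (d : ℕ) : Prop :=
  (∃ c ∈ C, c ≠ 0 ∧ wt c = d) ∧ ∀ c ∈ C, c ≠ 0 → d ≤ wt c

/-- `Awt C i` is the number `A_i(C)` of codewords of `C` of weight `i`. -/
noncomputable def Awt {ι : Type*} [Fintype ι]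
    (C : Submodule (ZMod 2) (ι → ZMod 2)) (i : ℕ) : ℕ :=
  Set.ncard {c ∈ (C : Set (ι → ZMod 2)) | wt c = i}

/-- `C` performs better than `C'`: the weight distribution of `C` is
lexicographically smaller than that of `C'`. -/
def LexSmaller {ι : Type*} [Fintype ι]
    (C C' : Submodule (ZMod 2) (ι → ZMod 2)) : Prop :=
  ∃ s : ℕ, (∀ i < s, Awt C i = Awt C' i) ∧ Awt C s < Awt C' s

/-- A circulant matrix: each row is the cyclic shift (by one position) of the previous one,
equivalently the matrix is invariant under simultaneously cyclically shifting rows and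
columns. -/
def IsCirculant {n : ℕ} (R : Matrix (Fin n) (Fin n) (ZMod 2)) : Prop :=
  ∀ i j k : Fin n, R (i + k) (j + k) = R i j

/-- The generator matrix `(I_n | R)`. -/
def genMat {n : ℕ} (R : Matrix (Fin n) (Fin n) (ZMod 2)) :
    Matrix (Fin n) (Fin n ⊕ Fin n) (ZMod 2) :=
  Matrix.of fun i => Sum.elim (fun j => if i = j then (1 : ZMod 2) else 0) (R i)

/-- The row space (span of the rows) of a matrix over `ZMod 2`. -/
def rowSpan {ι κ : Type*} (M : Matrix ι κ (ZMod 2)) : Submodule (ZMod 2) (κ → ZMod 2) :=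
  Submodule.span (ZMod 2) (Set.range M)

/-- The bordered matrix `B` with `B 0 0 = α`, the rest of the first row and first
column all ones, and remaining block the matrix `R'`. -/
def borderMat {m : ℕ} (α : ZMod 2) (R' : Matrix (Fin m) (Fin m) (ZMod 2)) :
    Matrix (Fin (m + 1)) (Fin (m + 1)) (ZMod 2) :=
  Matrix.of fun i j =>
    if hi : i = 0 then (if j = 0 then α else 1)
    else if hj : j = 0 then 1
    else R' (i.pred hi) (j.pred hj)

/-- `C` is a pure double circulant code of length `2n`. -/
def IsPureDC {n : ℕ} (C : Submodule (ZMod 2) (Fin n ⊕ Fin n → ZMod 2)) : Prop :=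
  ∃ R : Matrix (Fin n) (Fin n) (ZMod 2), IsCirculant R ∧ C = rowSpan (genMat R)

/-- `C` is a bordered double circulant code of length `2(m+1)`. -/
def IsBorderedDC {m : ℕ} (C : Submodule (ZMod 2) (Fin (m + 1) ⊕ Fin (m + 1) → ZMod 2)) : Prop :=
  ∃ (α : ZMod 2) (R' : Matrix (Fin m) (Fin m) (ZMod 2)),
    IsCirculant R' ∧ C = rowSpan (genMat (borderMat α R'))

/-- `C` is a double circulant code: pure or bordered. -/
def IsDC {m : ℕ} (C : Submodule (ZMod 2) (Fin (m + 1) ⊕ Fin (m + 1) → ZMod 2)) : Prop :=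
  IsPureDC C ∨ IsBorderedDC C

/-- The dual of a set of vectors. -/
def dualSet {ι : Type*} [Fintype ι] (X : Set (ι → ZMod 2)) : Set (ι → ZMod 2) :=
  {x | ∀ c ∈ X, ∑ i, x i * c i = 0}

/-- The shadow `S = C_0^⊥ \ C` of `C`, where `C_0` is the doubly even subcode. -/
def shadowSet {ι : Type*} [Fintype ι] (C : Submodule (ZMod 2) (ι → ZMod 2)) :
    Set (ι → ZMod 2) :=
  dualSet {c ∈ (C : Set (ι → ZMod 2)) | 4 ∣ wt c} \ (C : Set (ι → ZMod 2))

open Finset Polynomial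

/-- The nontrivial character of `ZMod 2`, with values in `ℤ`. -/
def binarySign (a : ZMod 2) : ℤ := if a = 0 then 1 else -1

theorem binarySign_add (a b : ZMod 2) :
    binarySign (a + b) = binarySign a * binarySign b := by
  revert a b; decide

theorem binarySign_sum {κ : Type*} (s : Finset κ) (f : κ → ZMod 2) :
    binarySign (∑ t ∈ s, f t) = ∏ t ∈ s, binarySign (f t) := by
  classical
  induction s using Finset.induction_on with
  | empty => simp [binarySign]
  | insert a s ha ih => rw [sum_insert ha, prod_insert ha, binarySign_add, ih]

section Moments

variable {ι : Type*} [Fintype ι]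

theorem wt_le_card (x : ι → ZMod 2) : wt x ≤ Fintype.card ι :=
  card_filter_le _ _

theorem sum_binarySign_eq (x : ι → ZMod 2) :
    ∑ i, binarySign (x i) = (Fintype.card ι : ℤ) - 2 * wt x := by
  have h (i : ι) : binarySign (x i) = 1 - 2 * if x i ≠ 0 then (1 : ℤ) else 0 := by
    by_cases hi : x i = 0 <;> simp [binarySign, hi]
  simp_rw [h, sum_sub_distrib, ← mul_sum, sum_boole]
  simp [wt]

theorem wt_add_one (x : ι → ZMod 2) : wt (x + 1) = Fintype.card ι - wt x := by
  classical
  have h : (univ.filter fun i => (x + 1) i ≠ 0) = (univ.filter fun i => x i ≠ 0)ᶜ := by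
    ext i
    have : ∀ a : ZMod 2, a + 1 ≠ 0 ↔ ¬ a ≠ 0 := by decide
    simpa using this (x i)
  rw [wt, h, card_compl, wt]

theorem cast_wt (x : ι → ZMod 2) : (wt x : ZMod 2) = ∑ i, x i := by
  have h (a : ZMod 2) : a = if a ≠ 0 then 1 else 0 := by revert a; decide
  rw [sum_congr rfl fun i _ => h (x i), sum_boole, wt]

theorem wt_eq_zero_iff (x : ι → ZMod 2) : wt x = 0 ↔ x = 0 := by
  simp [wt, filter_eq_empty_iff, funext_iff]

/-- Orthogonality of characters for a binary linear code. -/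
theorem sum_binarySign_dotProduct [DecidableEq ι] (C : Submodule (ZMod 2) (ι → ZMod 2))
    [Fintype C] (v : ι → ZMod 2) [Decidable (v ∈ dualCode C)] :
    ∑ c : C, binarySign (∑ i, v i * (c : ι → ZMod 2) i) =
      if v ∈ dualCode C then (Fintype.card C : ℤ) else 0 := by
  split_ifs with hv
  · rw [sum_congr rfl fun c _ => by rw [hv c c.2]]
    simp [binarySign]
  · obtain ⟨d, hd, hvd⟩ : ∃ d ∈ C, ∑ i, v i * d i ≠ 0 := by
      by_contra! h
      exact hv h
    have hshift := Fintype.sum_equiv (Equiv.addRight (⟨d, hd⟩ : C))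
      (fun c : C => -binarySign (∑ i, v i * (c : ι → ZMod 2) i))
      (fun c : C => binarySign (∑ i, v i * (c : ι → ZMod 2) i)) fun c => by
        simp [mul_add, sum_add_distrib, binarySign_add,
          show binarySign (∑ i, v i * d i) = -1 from if_neg hvd]
    rw [sum_neg_distrib] at hshift
    linarith

/-- The power moments of the weights of a code below its dual distance. -/
theorem sum_pow_wt [DecidableEq ι] (C : Submodule (ZMod 2) (ι → ZMod 2)) [Fintype C] (m : ℕ)
    (hC : ∀ v ∈ dualCode C, v ≠ 0 → m < wt v) :
    ∑ c : C, ((Fintype.card ι : ℤ) - 2 * wt (c : ι → ZMod 2)) ^ m =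
      Fintype.card C *
        #{f : Fin m → ι | ∑ t, (Pi.single (f t) 1 : ι → ZMod 2) = 0} := by
  classical
  have hprod (f : Fin m → ι) (c : ι → ZMod 2) :
      ∏ t, binarySign (c (f t)) =
        binarySign (∑ i, (∑ t, (Pi.single (f t) 1 : ι → ZMod 2)) i * c i) := by
    rw [← binarySign_sum]
    simp_rw [Finset.sum_apply, sum_mul]
    rw [sum_comm]
    simp [Pi.single_apply]
  have hwt (f : Fin m → ι) : wt (∑ t, (Pi.single (f t) 1 : ι → ZMod 2)) ≤ m := by
    refine (card_le_card (t := univ.image f) fun i hi => ?_).trans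
      (card_image_le.trans_eq (card_fin m))
    by_contra hf
    refine (mem_filter.1 hi).2 ?_
    rw [Finset.sum_apply]
    refine sum_eq_zero fun t _ => Pi.single_eq_of_ne ?_ _
    rintro rfl
    exact hf (mem_image_of_mem f (mem_univ t))
  have hmem (f : Fin m → ι) : ∑ t, (Pi.single (f t) 1 : ι → ZMod 2) ∈ dualCode C ↔
      ∑ t, (Pi.single (f t) 1 : ι → ZMod 2) = 0 :=
    ⟨fun h => by_contra fun h0 => (hC _ h h0).not_ge (hwt f), fun h => h ▸ zero_mem _⟩
  simp_rw [← sum_binarySign_eq, Fintype.sum_pow, hprod]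
  rw [sum_comm]
  simp_rw [sum_binarySign_dotProduct, hmem]
  rw [← sum_filter, sum_const, nsmul_eq_mul, mul_comm]

theorem dualCode_top : dualCode (⊤ : Submodule (ZMod 2) (ι → ZMod 2)) = ⊥ := by
  classical
  refine (Submodule.eq_bot_iff _).2 fun v hv => funext fun i => ?_
  simpa [Pi.single_apply] using hv (Pi.single i 1) trivial

theorem sum_wt_eq_sum_Awt (C : Submodule (ZMod 2) (ι → ZMod 2)) [Fintype C] (g : ℕ → ℤ) :
    ∑ c : C, g (wt (c : ι → ZMod 2)) =
      ∑ i ∈ range (Fintype.card ι + 1), (Awt C i : ℤ) * g i := by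
  classical
  rw [← sum_fiberwise_of_maps_to (t := range (Fintype.card ι + 1))
    (g := fun c : C => wt (c : ι → ZMod 2))
    fun c _ => mem_range.2 (Nat.lt_succ_of_le (wt_le_card _))]
  refine sum_congr rfl fun i _ => ?_
  rw [sum_congr rfl fun c hc => by rw [(mem_filter.1 hc).2], sum_const, nsmul_eq_mul]
  congr 2
  rw [Awt, ← Set.ncard_coe_finset, ← Set.ncard_image_of_injective _ Subtype.val_injective]
  congr 1
  ext x
  simp [and_comm]

theorem Awt_top (i : ℕ) :
    Awt (⊤ : Submodule (ZMod 2) (ι → ZMod 2)) i = (Fintype.card ι).choose i := by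
  classical
  rw [← card_univ, ← card_powersetCard, ← Set.ncard_coe_finset, Awt]
  refine Set.ncard_congr (fun x _ => univ.filter fun j => x j ≠ 0) ?_ ?_ ?_
  · rintro x ⟨-, hx⟩
    exact mem_powersetCard.2 ⟨subset_univ _, hx⟩
  · intro x y _ _ h
    have hxy : ∀ a b : ZMod 2, (a ≠ 0 ↔ b ≠ 0) → a = b := by decide
    funext j
    exact hxy _ _ (by simpa using Finset.ext_iff.1 h j)
  · intro s hs
    refine ⟨fun j => if j ∈ s then 1 else 0, ⟨trivial, ?_⟩, ?_⟩
    · simpa [wt] using (mem_powersetCard.1 hs).2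
    · ext j; simp

/-- Below the dual distance, the weights of a code average polynomials like the binomial
distribution. -/
theorem sum_Awt_mul_eval [DecidableEq ι] (C : Submodule (ZMod 2) (ι → ZMod 2)) (p : ℤ[X])
    (hC : ∀ v ∈ dualCode C, v ≠ 0 → p.natDegree < wt v) :
    2 ^ Fintype.card ι *
        ∑ i ∈ range (Fintype.card ι + 1), (Awt C i : ℤ) * p.eval (Fintype.card ι - 2 * i : ℤ) =
      2 ^ Module.finrank (ZMod 2) C *
        ∑ i ∈ range (Fintype.card ι + 1),
          ((Fintype.card ι).choose i : ℤ) * p.eval (Fintype.card ι - 2 * i : ℤ) := by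
  classical
  have key (D : Submodule (ZMod 2) (ι → ZMod 2))
      (hD : ∀ v ∈ dualCode D, v ≠ 0 → p.natDegree < wt v) :
      ∑ i ∈ range (Fintype.card ι + 1), (Awt D i : ℤ) * p.eval (Fintype.card ι - 2 * i : ℤ) =
        2 ^ Module.finrank (ZMod 2) D * ∑ m ∈ range (p.natDegree + 1), p.coeff m *
          #{f : Fin m → ι | ∑ t, (Pi.single (f t) 1 : ι → ZMod 2) = 0} := by
    rw [← sum_wt_eq_sum_Awt D fun i => p.eval (Fintype.card ι - 2 * i : ℤ)]
    simp_rw [eval_eq_sum_range]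
    rw [sum_comm, mul_sum]
    refine sum_congr rfl fun m hm => ?_
    rw [← mul_sum, sum_pow_wt D m fun v hv h0 =>
      (Nat.lt_succ_iff.1 (mem_range.1 hm)).trans_lt (hD v hv h0),
      Module.card_eq_pow_finrank (K := ZMod 2), ZMod.card]
    push_cast
    ring
  have htop := key ⊤ fun v hv h0 => absurd (by simpa [dualCode_top] using hv) h0
  simp_rw [Awt_top] at htop
  rw [key C hC, htop, finrank_top, Module.finrank_fintype_fun_eq_card]
  ring

theorem Awt_zero (C : Submodule (ZMod 2) (ι → ZMod 2)) : Awt C 0 = 1 := by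
  rw [Awt, Set.ncard_eq_one]
  refine ⟨0, ?_⟩
  ext x
  simp only [wt_eq_zero_iff, Set.mem_ofPred_eq, Set.mem_singleton_iff, SetLike.mem_coe]
  exact ⟨And.right, fun h => ⟨h ▸ zero_mem C, h⟩⟩

theorem Awt_card_sub {C : Submodule (ZMod 2) (ι → ZMod 2)} (h1 : 1 ∈ C) {i : ℕ}
    (hi : i ≤ Fintype.card ι) : Awt C (Fintype.card ι - i) = Awt C i := by
  refine (Set.ncard_congr (fun x _ => x + 1) ?_ ?_ ?_).symm
  · rintro x ⟨hx, rfl⟩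
    exact ⟨add_mem hx h1, wt_add_one x⟩
  · intro x y _ _ h
    exact add_right_cancel h
  · rintro y ⟨hy, hwt⟩
    refine ⟨y + 1, ⟨add_mem hy h1, ?_⟩, ?_⟩
    · rw [wt_add_one, hwt]; omega
    · funext j
      simp [add_assoc, CharTwo.add_self_eq_zero]

theorem IsSelfDual.one_mem {C : Submodule (ZMod 2) (ι → ZMod 2)} (hC : IsSelfDual C)
    (heven : IsEvenCode C) : 1 ∈ C := by
  rw [hC]
  intro c hc
  simpa [← cast_wt] using (ZMod.natCast_eq_zero_iff _ _).2 (heven c hc)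

theorem Awt_eq_zero {C : Submodule (ZMod 2) (ι → ZMod 2)} {i : ℕ}
    (h : ∀ c ∈ C, wt c ≠ i) : Awt C i = 0 := by
  rw [Awt, Set.ncard_eq_zero (Set.toFinite _), Set.eq_empty_iff_forall_notMem]
  exact fun c hc => h c hc.1 hc.2

end Moments

/-- The even polynomial whose roots are `± 8 j` for `j ∈ s`. -/
noncomputable def evenNodePoly (s : Finset ℕ) : ℤ[X] :=
  ∏ j ∈ s, (X ^ 2 - C (64 * (j : ℤ) ^ 2))

theorem eval_evenNodePoly (s : Finset ℕ) (x : ℤ) :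
    (evenNodePoly s).eval x = ∏ j ∈ s, (x ^ 2 - 64 * (j : ℤ) ^ 2) := by
  simp [evenNodePoly, eval_prod]

theorem natDegree_evenNodePoly (s : Finset ℕ) : (evenNodePoly s).natDegree = 2 * #s := by
  rw [evenNodePoly, natDegree_prod_of_monic _ _ fun j _ => monic_X_pow_sub_C _ two_ne_zero]
  simp only [natDegree_X_pow_sub_C, sum_const, smul_eq_mul, mul_comm]

/-- Even interpolation isolates the number of codewords of weight `56 - 4 * k`. -/
theorem extremal_weight_equation (C : Submodule (ZMod 2) (Fin 112 → ZMod 2))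
    (hsd : IsSelfDual C) (hdim : Module.finrank (ZMod 2) C = 56)
    (hde : ∀ c ∈ C, 4 ∣ wt c) (hmin : ∀ c ∈ C, c ≠ 0 → 20 ≤ wt c)
    {k : ℕ} (hk0 : 0 < k) (hk : k < 10) :
    2 ^ 57 * ((evenNodePoly ((range 10).erase k)).eval 112 +
        Awt C (56 - 4 * k) * (evenNodePoly ((range 10).erase k)).eval (8 * k : ℤ)) =
      ∑ i ∈ range 113, (Nat.choose 112 i : ℤ) *
        (evenNodePoly ((range 10).erase k)).eval (112 - 2 * i : ℤ) := by
  set p := evenNodePoly ((range 10).erase k) with hp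
  have hdeg : p.natDegree = 18 := by
    rw [hp, natDegree_evenNodePoly, card_erase_of_mem (mem_range.2 hk), card_range]
  have hmom := sum_Awt_mul_eval C p fun v hv h0 => by
    rw [hdeg]
    have := hmin v (by rwa [hsd]) h0
    omega
  rw [Fintype.card_fin, hdim] at hmom
  have h1 : 1 ∈ C := hsd.one_mem fun c hc => (by norm_num : 2 ∣ 4).trans (hde c hc)
  have hsymm {i : ℕ} (hi : i ≤ 112) : Awt C (112 - i) = Awt C i := by
    simpa using Awt_card_sub h1 (i := i) (by simpa using hi)
  have hsmall {i : ℕ} (hi0 : 0 < i) (hi : i < 20) : Awt C i = 0 :=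
    Awt_eq_zero fun c hc hwt => by
      have := hmin c hc fun h => by rw [(wt_eq_zero_iff c).2 h] at hwt; omega
      omega
  have heven (x : ℤ) : p.eval (-x) = p.eval x := by
    simp [hp, eval_evenNodePoly]
  have hroot (j : ℕ) (hj : j < 10) (hjk : j ≠ k) : p.eval (8 * j : ℤ) = 0 := by
    rw [hp, eval_evenNodePoly]
    exact prod_eq_zero (mem_erase.2 ⟨hjk, mem_range.2 hj⟩) (by ring)
  have hvanish (i : ℕ) (hi : i ∈ range 113)
      (hni : i ∉ ({0, 56 - 4 * k, 56 + 4 * k, 112} : Finset ℕ)) :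
      (Awt C i : ℤ) * p.eval (112 - 2 * i : ℤ) = 0 := by
    simp only [mem_insert, mem_singleton, not_or, mem_range] at hi hni
    by_cases h4 : 4 ∣ i
    · by_cases hlo : i < 20
      · rw [hsmall (by omega) hlo]; simp
      by_cases hhi : 92 < i
      · rw [← hsymm (by omega), hsmall (by omega) (by omega)]; simp
      refine mul_eq_zero_of_right _ ?_
      by_cases hle : i ≤ 56
      · have := hroot ((56 - i) / 4) (by omega) (by omega)
        rwa [show (8 * ((56 - i) / 4 : ℕ) : ℤ) = 112 - 2 * i by omega] at this
      · have := hroot ((i - 56) / 4) (by omega) (by omega)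
        rwa [← heven, show (-(8 * ((i - 56) / 4 : ℕ)) : ℤ) = 112 - 2 * i by omega] at this
    · rw [Awt_eq_zero (i := i) fun c hc hwt => h4 (hwt ▸ hde c hc)]; simp
  have hsum : ∑ i ∈ range 113, (Awt C i : ℤ) * p.eval (112 - 2 * i : ℤ) =
      2 * (p.eval 112 + Awt C (56 - 4 * k) * p.eval (8 * k : ℤ)) := by
    rw [← sum_subset (s₁ := {0, 56 - 4 * k, 56 + 4 * k, 112}) _ hvanish]
    · rw [sum_insert, sum_insert, sum_insert, sum_singleton]
      · have h112 := hsymm (i := 0) (by norm_num)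
        have hmid := hsymm (i := 56 - 4 * k) (by omega)
        rw [show 112 - (56 - 4 * k) = 56 + 4 * k by omega] at hmid
        rw [Nat.sub_zero, Awt_zero] at h112
        rw [hmid, h112, Awt_zero,
          show (112 - 2 * (56 - 4 * k : ℕ) : ℤ) = 8 * k by omega,
          show (112 - 2 * (56 + 4 * k : ℕ) : ℤ) = -(8 * k) by push_cast; ring, heven,
          show (112 - 2 * (112 : ℕ) : ℤ) = -112 by norm_num, heven]
        push_cast
        ring_nf
      all_goals simp only [mem_insert, mem_singleton]; omega
    · intro i hi
      simp only [mem_insert, mem_singleton, mem_range] at hi ⊢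
      omega
  rw [show (112 : ℕ) + 1 = 113 from rfl] at hmom
  push_cast at hmom
  rw [hsum] at hmom
  linarith

/-- Every doubly even self-dual `[112, 56]` code with minimum weight 20 has
exactly 355740 codewords of weight 20, 95307030 of weight 24, and 10847290300 of
weight 28. -/
theorem stmt_9 (C : Submodule (ZMod 2) (Fin 112 → ZMod 2))
    (hsd : IsSelfDual C) (hdim : Module.finrank (ZMod 2) C = 56)
    (hde : ∀ c ∈ C, 4 ∣ wt c) (hmin : HasMinWt C 20) :
    Awt C 20 = 355740 ∧ Awt C 24 = 95307030 ∧ Awt C 28 = 10847290300 := by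
  have h20 := extremal_weight_equation C hsd hdim hde hmin.2 (k := 9) (by norm_num) (by norm_num)
  have h24 := extremal_weight_equation C hsd hdim hde hmin.2 (k := 8) (by norm_num) (by norm_num)
  have h28 := extremal_weight_equation C hsd hdim hde hmin.2 (k := 7) (by norm_num) (by norm_num)
  rw [show (range 10).erase 9 = {0, 1, 2, 3, 4, 5, 6, 7, 8} by decide] at h20
  rw [show (range 10).erase 8 = {0, 1, 2, 3, 4, 5, 6, 7, 9} by decide] at h24
  rw [show (range 10).erase 7 = {0, 1, 2, 3, 4, 5, 6, 8, 9} by decide] at h28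
  norm_num [eval_evenNodePoly, sum_range_succ, Nat.choose_eq_descFactorial_div_factorial]
    at h20 h24 h28
  omega
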